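/- Degree bounds for ranged transition matrices: Let F be a field, t ≥ 1, and let g_{i,j} ∈ F[X] satisfy deg(g_{i,j}) ≤ j for all i ≥ 1 and 1 ≤ j ≤ t. Then for all 0 ≤ ℓ ≤ r and all 0 ≤ i, j ≤ t−1, the entry T_{[ℓ:r]}[i,j] of the ranged transition matrix is a polynomial of degree at most max(r − ℓ + i − j, 0) (the zero polynomial, of degree −∞, being allowed). -/

import Mathlib

open Polynomial Matrix

/-- The transition matrix `T_i`: a `t × t` matrix over `F[X]` whose superdiagonal entries are `1`
and whose last row contains `g (i+1) (t - b)` in column `b`. -/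
noncomputable def transitionMatrix (F : Type*) [Field F] (t : ℕ) (g : ℕ → ℕ → Polynomial F) (i : ℕ) :
    Matrix (Fin t) (Fin t) (Polynomial F) :=
  Matrix.of fun a b =>
    if (a : ℕ) = t - 1 then g (i + 1) (t - (b : ℕ))
    else if (b : ℕ) = (a : ℕ) + 1 then 1 else 0

/-- The ranged transition matrix `T_{[ℓ:r]} = T_{r-1} · T_{r-2} ⋯ T_ℓ`
(the identity when `r = ℓ`). -/
noncomputable def rangedTransition (F : Type*) [Field F] (t : ℕ) (g : ℕ → ℕ → Polynomial F) (ℓ r : ℕ) :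
    Matrix (Fin t) (Fin t) (Polynomial F) :=
  ((List.range (r - ℓ)).map fun k => transitionMatrix F t g (r - 1 - k)).prod

open Polynomial Matrix

lemma ranged_aux (F : Type*) [Field F] (t : ℕ)
    (g : ℕ → ℕ → Polynomial F)
    (hdeg : ∀ i j : ℕ, 1 ≤ i → 1 ≤ j → j ≤ t → (g i j).degree ≤ (j : WithBot ℕ)) (n : ℕ) :
    ∀ (s : ℕ → ℕ) (i j : Fin t),
      ((n + (i : ℕ) < j →
        ((List.range n).map fun k => transitionMatrix F t g (s k)).prod i j = 0) ∧
      (((List.range n).map fun k => transitionMatrix F t g (s k)).prod i j).degree ≤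
        ((n + (i : ℕ) - (j : ℕ) : ℕ) : WithBot ℕ)) := by
  induction n with
  | zero =>
    intro s i j
    simp only [List.range_zero, List.map_nil, List.prod_nil]
    constructor
    · intro h
      exact Matrix.one_apply_ne (fun e => by subst e; omega)
    · by_cases e : i = j
      · subst e
        simp
      · rw [Matrix.one_apply_ne e]
        simp
  | succ n ih =>
    intro s i j
    have ih' := ih (fun k => s (k + 1))
    rw [List.range_succ_eq_map, List.map_cons, List.map_map, List.prod_cons, Matrix.mul_apply]
    simp only [Function.comp_def, Nat.succ_eq_add_one]
    generalize ((List.range n).map fun k => transitionMatrix F t g (s (k + 1))).prod = P at ih' ⊢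
    have hi := i.2
    have hj := j.2
    by_cases hl : (i : ℕ) = t - 1
    · refine ⟨fun h => by omega, ?_⟩
      refine (Polynomial.degree_sum_le _ _).trans (Finset.sup_le fun b _ => ?_)
      have hb := b.2
      by_cases hz : n + (b : ℕ) < j
      · rw [(ih' b j).1 hz]
        simp
      · simp only [transitionMatrix, Matrix.of_apply, if_pos hl]
        refine (Polynomial.degree_mul_le _ _).trans
          ((add_le_add (hdeg _ _ (by omega) (by omega) (by omega)) (ih' b j).2).trans ?_)
        norm_cast
        omega
    · have hs : ∑ b, transitionMatrix F t g (s 0) i b * P b j = P ⟨i + 1, by omega⟩ j := by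
        rw [Finset.sum_eq_single ⟨i + 1, by omega⟩]
        · simp [transitionMatrix, hl]
        · intro b _ hb
          have : (b : ℕ) ≠ i + 1 := fun e => hb (Fin.ext e)
          simp [transitionMatrix, hl, this]
        · simp
      rw [hs]
      have := ih' ⟨i + 1, by omega⟩ j
      refine ⟨fun h => this.1 (by simp only; omega), this.2.trans ?_⟩
      norm_cast
      simp only
      omega

/-- **Degree bounds for ranged transition matrices.** If `deg (g i j) ≤ j` for a degree-(1,0)
recurrence of width `t`, then the `(i,j)` entry of `T_{[ℓ:r]}` has degree at most
`max (r - ℓ + i - j) 0` (computed by truncated natural subtraction). -/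
theorem degree_bound_ranged_transition
    (F : Type*) [Field F] (t : ℕ) (ht : 1 ≤ t)
    (g : ℕ → ℕ → Polynomial F)
    (hdeg : ∀ i j : ℕ, 1 ≤ i → 1 ≤ j → j ≤ t → (g i j).degree ≤ (j : WithBot ℕ))
    (hzero : ∀ i j : ℕ, (i < j ∨ t < j) → g i j = 0) :
    ∀ (ℓ r : ℕ), ℓ ≤ r → ∀ (i j : Fin t),
      (rangedTransition F t g ℓ r i j).degree ≤
        ((r - ℓ + (i : ℕ) - (j : ℕ) : ℕ) : WithBot ℕ) := by
  intro ℓ r _ i j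
  exact (ranged_aux F t g hdeg (r - ℓ) (fun k => r - 1 - k) i j).2
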